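/- Let R = [r] × [s], let x ∈ ℝ_{>0}^R, and let x̃ = φ(ρ⁻¹(φ⁻¹(x))). Then for all k ≥ 1 and all 1 ≤ i, j ≤ r + s − k, the arrays of path weights satisfy W_{ij}^{(k)}(x̃) = W_{i+1, j+1}^{(k)}(x). -/

import Mathlib

namespace Paper

/-- Membership in the rectangle poset `R = [1,r] × [1,s]` (coordinates in `ℤ`). -/
def inR (r s : ℕ) (p : ℤ × ℤ) : Prop :=
  1 ≤ p.1 ∧ p.1 ≤ (r : ℤ) ∧ 1 ≤ p.2 ∧ p.2 ≤ (s : ℤ)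

instance (r s : ℕ) : DecidablePred (inR r s) := fun _ => by unfold inR; infer_instance

/-- The cover relation in the product of two chains. -/
def CoverStep (p q : ℤ × ℤ) : Prop :=
  (q.1 = p.1 + 1 ∧ q.2 = p.2) ∨ (q.1 = p.1 ∧ q.2 = p.2 + 1)

/-- Upper covers of `p` inside the rectangle. -/
def upSet (r s : ℕ) (p : ℤ × ℤ) : Finset (ℤ × ℤ) :=
  ({(p.1 + 1, p.2), (p.1, p.2 + 1)} : Finset (ℤ × ℤ)).filter (inR r s)

/-- Lower covers of `p` inside the rectangle. -/
def downSet (r s : ℕ) (p : ℤ × ℤ) : Finset (ℤ × ℤ) :=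
  ({(p.1 - 1, p.2), (p.1, p.2 - 1)} : Finset (ℤ × ℤ)).filter (inR r s)

/-- Sum of the labels of the lower covers of `p` (empty sum = 1). -/
noncomputable def dsum (r s : ℕ) (x : ℤ × ℤ → ℝ) (p : ℤ × ℤ) : ℝ :=
  if (downSet r s p).Nonempty then ∑ q ∈ downSet r s p, x q else 1

/-- Parallel sum of the labels of the upper covers of `p` (empty parallel sum = 1). -/
noncomputable def usum (r s : ℕ) (x : ℤ × ℤ → ℝ) (p : ℤ × ℤ) : ℝ :=
  if (upSet r s p).Nonempty then (∑ q ∈ upSet r s p, (x q)⁻¹)⁻¹ else 1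

/-- The birational toggle at `p`. -/
noncomputable def toggle (r s : ℕ) (p : ℤ × ℤ) (x : ℤ × ℤ → ℝ) : ℤ × ℤ → ℝ :=
  fun q => if q = p then usum r s x p * dsum r s x p / x p else x q

/-- The elements of `[1,a] × [1,b]` listed from top to bottom
(descending lexicographic order, the reverse of a linear extension). -/
def rectList (a b : ℕ) : List (ℤ × ℤ) :=
  (List.range a).reverse.flatMap fun i =>
    (List.range b).reverse.map fun j => ((i : ℤ) + 1, (j : ℤ) + 1)

/-- Birational rowmotion on the rectangle: toggles from top to bottom. -/
noncomputable def rho (r s : ℕ) (x : ℤ × ℤ → ℝ) : ℤ × ℤ → ℝ :=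
  (rectList r s).foldl (fun y p => toggle r s p y) x

/-- Inverse birational rowmotion: toggles from bottom to top. -/
noncomputable def rhoInv (r s : ℕ) (x : ℤ × ℤ → ℝ) : ℤ × ℤ → ℝ :=
  (rectList r s).reverse.foldl (fun y p => toggle r s p y) x

/-- Integer powers of birational rowmotion. -/
noncomputable def rhoPow (r s : ℕ) (k : ℤ) (x : ℤ × ℤ → ℝ) : ℤ × ℤ → ℝ :=
  if 0 ≤ k then (rho r s)^[k.toNat] x else (rhoInv r s)^[(-k).toNat] x

/-- Saturated chains from `a` to `b`, as lists of successive cover steps. -/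
def ChainList (a b : ℤ × ℤ) : Type :=
  {l : List (ℤ × ℤ) // l.Chain' CoverStep ∧ l.head? = some a ∧ l.getLast? = some b}

/-- The inverse birational transfer map on the rectangle: `φ⁻¹(x)_p` is the total weight
of all saturated chains from the minimal element `(1,1)` to `p`. -/
noncomputable def phiInv (x : ℤ × ℤ → ℝ) : ℤ × ℤ → ℝ :=
  fun p => ∑ᶠ c : ChainList (1, 1) p, (c.1.map x).prod

/-- The birational transfer map `φ(x)_p = x_p / ∑_{q ⋖ p} x_q`. -/
noncomputable def phi (r s : ℕ) (x : ℤ × ℤ → ℝ) : ℤ × ℤ → ℝ :=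
  fun p => x p / dsum r s x p

/-- A collection of `k` pairwise vertex-disjoint lattice paths in the interval
`[i₁,i₂] × [j₁,j₂]`, from `(i₁,j₁),…,(i₁,j₁+k-1)` to `(i₂,j₂-k+1),…,(i₂,j₂)`. -/
structure RSys (i₁ i₂ j₁ j₂ : ℤ) (k : ℕ) where
  path : Fin k → List (ℤ × ℤ)
  chain : ∀ t, (path t).Chain' CoverStep
  mem : ∀ t, ∀ v ∈ path t, i₁ ≤ v.1 ∧ v.1 ≤ i₂ ∧ j₁ ≤ v.2 ∧ v.2 ≤ j₂
  first : ∀ t : Fin k, (path t).head? = some (i₁, j₁ + ((t : ℕ) : ℤ))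
  final : ∀ t : Fin k, (path t).getLast? = some (i₂, j₂ - k + 1 + ((t : ℕ) : ℤ))
  disjoint : ∀ t t' : Fin k, t ≠ t' → ∀ v ∈ path t, v ∉ path t'

/-- The weight of a collection of paths: the product of labels of all its elements. -/
noncomputable def RSysWeight (x : ℤ × ℤ → ℝ) {i₁ i₂ j₁ j₂ : ℤ} {k : ℕ}
    (L : RSys i₁ i₂ j₁ j₂ k) : ℝ :=
  ∏ t : Fin k, ((L.path t).map x).prod

/-- `w_I^{(k)}(x)`: total weight of all collections of `k` nonintersecting paths in the
interval `I = [i₁,i₂] × [j₁,j₂]` (with `w_I^{(0)} = 1`). -/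
noncomputable def w (i₁ i₂ j₁ j₂ : ℤ) (k : ℤ) (x : ℤ × ℤ → ℝ) : ℝ :=
  if k ≤ 0 then 1 else ∑ᶠ L : RSys i₁ i₂ j₁ j₂ k.toNat, RSysWeight x L

/-- `w_I(x)`: the product of all labels in the interval `I = [i₁,i₂] × [j₁,j₂]`. -/
noncomputable def wProd (i₁ i₂ j₁ j₂ : ℤ) (x : ℤ × ℤ → ℝ) : ℝ :=
  ∏ p ∈ Finset.Icc i₁ i₂ ×ˢ Finset.Icc j₁ j₂, x p

/-- The directed edges of the graph `𝒢_R` on vertex set `[1,r+1] × [1,s]`: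
`(i,j) → (i+1,j)` for `(i,j) ∈ R`, and `(i,j) → (i+1,j-1)` when valid. -/
def GEdge (r s : ℕ) (p q : ℤ × ℤ) : Prop :=
  1 ≤ p.1 ∧ p.1 ≤ (r : ℤ) ∧ 1 ≤ p.2 ∧ p.2 ≤ (s : ℤ) ∧ q.1 = p.1 + 1 ∧
    (q.2 = p.2 ∨ (q.2 = p.2 - 1 ∧ 2 ≤ p.2))

/-- The weight of an edge of `𝒢_R`: `x_p⁻¹` for vertical edges, `1` for diagonal ones. -/
noncomputable def edgeWt (x : ℤ × ℤ → ℝ) (p q : ℤ × ℤ) : ℝ :=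
  if q.2 = p.2 then (x p)⁻¹ else 1

/-- The weight of a directed path in `𝒢_R`, given as its list of vertices. -/
noncomputable def listWt (x : ℤ × ℤ → ℝ) (l : List (ℤ × ℤ)) : ℝ :=
  ((l.zip l.tail).map fun e => edgeWt x e.1 e.2).prod

/-- The boundary vertex `P_t` of `𝒢_R`: `P_j = (1,j)` for `1 ≤ j ≤ s`, `P_{s+i} = (i+1,s)`. -/
def Pvert (s : ℕ) (t : ℤ) : ℤ × ℤ := if t ≤ (s : ℤ) then (1, t) else (t - s + 1, (s : ℤ))

/-- The boundary vertex `Q_t` of `𝒢_R`: `Q_i = (i,1)` for `1 ≤ i ≤ r`, `Q_{r+j} = (r+1,j)`. -/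
def Qvert (r : ℕ) (t : ℤ) : ℤ × ℤ := if t ≤ (r : ℤ) then (t, 1) else ((r : ℤ) + 1, t - r)

/-- A collection of `k` pairwise vertex-disjoint directed paths in `𝒢_R` from
`{P_i, …, P_{i+k-1}}` to `{Q_j, …, Q_{j+k-1}}`. -/
structure GSys (r s : ℕ) (i j : ℤ) (k : ℕ) where
  perm : Equiv.Perm (Fin k)
  path : Fin k → List (ℤ × ℤ)
  chain : ∀ t, (path t).Chain' (GEdge r s)
  first : ∀ t : Fin k, (path t).head? = some (Pvert s (i + ((t : ℕ) : ℤ)))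
  final : ∀ t : Fin k, (path t).getLast? = some (Qvert r (j + (((perm t) : ℕ) : ℤ)))
  disjoint : ∀ t t' : Fin k, t ≠ t' → ∀ v ∈ path t, v ∉ path t'

/-- The weight of a collection of paths in `𝒢_R`: the product of the weights of all
edges used. -/
noncomputable def GSysWeight (x : ℤ × ℤ → ℝ) {r s : ℕ} {i j : ℤ} {k : ℕ}
    (L : GSys r s i j k) : ℝ :=
  ∏ t : Fin k, listWt x (L.path t)

/-- `W_{ij}^{(k)}(x)`: total weight of all collections of `k` nonintersecting paths in
`𝒢_R` from `{P_i,…,P_{i+k-1}}` to `{Q_j,…,Q_{j+k-1}}`; `W_{ij}^{(0)} = 1`, and `0` when an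
out-of-range index occurs. -/
noncomputable def W (r s : ℕ) (x : ℤ × ℤ → ℝ) (i j k : ℤ) : ℝ :=
  if k < 0 then 0
  else if k = 0 then 1
  else if 1 ≤ i ∧ 1 ≤ j ∧ i + k - 1 ≤ (r : ℤ) + s ∧ j + k - 1 ≤ (r : ℤ) + s then
    ∑ᶠ L : GSys r s i j k.toNat, GSysWeight x L
  else 0



/-- Total weight of the lattice paths that start at column `b` of row `a`, cross `n` rows, each time
either staying in the column (weight `D`) or moving one column to the left (weight `1`), and end
in column `q`. -/
def pathSum (D : ℤ → ℤ → ℝ) : ℕ → ℤ → ℤ → ℤ → ℝ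
  | 0, _, b, q => if b = q then 1 else 0
  | n + 1, a, b, q => D a b * pathSum D n (a + 1) b q + pathSum D n (a + 1) (b - 1) q

theorem pathSum_eq_zero (D : ℤ → ℤ → ℝ) (n : ℕ) (a b q : ℤ) (h : q + n < b) :
    pathSum D n a b q = 0 := by
  induction n generalizing a b with
  | zero => rw [pathSum, if_neg]; push_cast at h; omega
  | succ n ih =>
    push_cast at h
    rw [pathSum, ih _ _ (by omega), ih _ _ (by omega)]; ring

/-- Only the weights between the antidiagonals of the start and of the end matter. -/
theorem pathSum_congr {D D' : ℤ → ℤ → ℝ} (n : ℕ) (a b q lo hi : ℤ)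
    (h : ∀ a b, lo ≤ a + b → a + b < hi → D a b = D' a b)
    (hlo : lo ≤ a + b) (hhi : a + n + q ≤ hi) :
    pathSum D n a b q = pathSum D' n a b q := by
  induction n generalizing a b with
  | zero => rfl
  | succ n ih =>
    push_cast at hhi
    rw [pathSum, pathSum, ih (a + 1) b (by omega) (by omega),
      ih (a + 1) (b - 1) (by omega) (by omega)]
    by_cases hab : a + b < hi
    · rw [h a b hlo hab]
    · rw [pathSum_eq_zero D' n (a + 1) b q (by omega)]; ring

theorem pathSum_shift_aux (v h : ℤ → ℤ → ℝ)
    (hvh : ∀ a b, v (a + 1) b * h (a + 1) (b + 1) = h a (b + 1) * v (a + 1) (b + 1))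
    (n : ℕ) (a b q : ℤ) (hv : ∀ b, v (a + n + 1) b = 0) :
    pathSum (fun a b => v (a + 1) b + h a (b + 1)) (n + 1) a b q =
      h a (b + 1) * pathSum (fun a b => v a b + h a b) n (a + 1) (b + 1) (q + 1) +
        pathSum (fun a b => v a b + h a b) n (a + 1) b (q + 1) := by
  induction n generalizing a b with
  | zero =>
    have := hv b
    simp only [Nat.cast_zero, add_zero] at this
    simp only [pathSum, this, add_left_inj, sub_eq_iff_eq_add]
    ring
  | succ n ih =>
    have hv' : ∀ b, v (a + 1 + n + 1) b = 0 := fun b => by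
      rw [← hv b]; congr 1; push_cast; ring
    rw [pathSum, ih _ _ hv', ih _ _ hv', pathSum, pathSum, sub_add_cancel, add_sub_cancel_right]
    linear_combination (pathSum (fun a b => v a b + h a b) n (a + 1 + 1) (b + 1) (q + 1)) * hvh a b

theorem pathSum_shift (v h : ℤ → ℤ → ℝ)
    (hvh : ∀ a b, v (a + 1) b * h (a + 1) (b + 1) = h a (b + 1) * v (a + 1) (b + 1))
    (n : ℕ) (a b q : ℤ) (hv : ∀ b, v (a + n) b = 0) (hv' : ∀ b, v a b = 0) :
    pathSum (fun a b => v (a + 1) b + h a (b + 1)) n a b q =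
      pathSum (fun a b => v a b + h a b) n a (b + 1) (q + 1) := by
  cases n with
  | zero => simp [pathSum]
  | succ n =>
    rw [pathSum_shift_aux v h hvh n a b q fun b => by
      rw [← hv b]; congr 1; push_cast; ring]
    simp [pathSum, hv']

/-- The columns after one row, where exactly the paths in `e` stay in their column. -/
def stepCol {k : ℕ} (e : Finset (Fin k)) (c : Fin k → ℤ) : Fin k → ℤ :=
  fun t => if t ∈ e then c t else c t - 1

/-- The columns after `m` rows, where the paths in `E m'` stay in their column in row `m'`. -/
def colAt {n k : ℕ} (E : Fin n → Finset (Fin k)) (c : Fin k → ℤ) (m : ℕ) : Fin k → ℤ :=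
  fun t => c t - ∑ m' : Fin n, if (m' : ℕ) < m ∧ t ∉ E m' then 1 else 0

@[simp] theorem colAt_zero {n k : ℕ} (E : Fin n → Finset (Fin k)) (c : Fin k → ℤ) :
    colAt E c 0 = c := by
  ext t; simp [colAt]

theorem colAt_cons {n k : ℕ} (e : Finset (Fin k)) (E : Fin n → Finset (Fin k)) (c : Fin k → ℤ)
    (m : ℕ) : colAt (Fin.cons e E : Fin (n + 1) → Finset (Fin k)) c (m + 1) =
      colAt E (stepCol e c) m := by
  ext t
  simp only [colAt, stepCol, Fin.sum_univ_succ, Fin.cons_zero, Fin.cons_succ, Fin.val_zero,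
    Fin.val_succ, Nat.add_lt_add_iff_right, Nat.zero_lt_succ, true_and]
  split_ifs <;> ring

theorem colAt_succ {n k : ℕ} (E : Fin n → Finset (Fin k)) (c : Fin k → ℤ) (m : Fin n) :
    colAt E c (m + 1) = stepCol (E m) (colAt E c m) := by
  ext t
  have h : ∀ m' : Fin n, (if (m' : ℕ) < m + 1 ∧ t ∉ E m' then (1 : ℤ) else 0) =
      (if (m' : ℕ) < m ∧ t ∉ E m' then 1 else 0) +
        if m' = m then (if t ∉ E m then 1 else 0) else 0 := by
    intro m'
    rcases lt_trichotomy m' m with h | rfl | h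
    · simp [h, h.ne, Nat.lt_succ_of_lt (Fin.lt_def.1 h)]
    · simp
    · have h' := Fin.lt_def.1 h
      simp [h.ne', show ¬ (m' : ℕ) < m + 1 by omega, show ¬ m' < m by omega]
  simp only [colAt, stepCol, h, Finset.sum_add_distrib, Finset.sum_ite_eq', Finset.mem_univ, if_true]
  split_ifs <;> ring

theorem stepCol_strictMono {k : ℕ} {e : Finset (Fin k)} {c : Fin k → ℤ} (hc : StrictMono c)
    (h : Function.Injective (stepCol e c)) : StrictMono (stepCol e c) := by
  refine Monotone.strictMono_of_injective (fun t u htu => ?_) h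
  rcases htu.eq_or_lt with rfl | htu
  · rfl
  · have := hc htu
    simp only [stepCol]; split_ifs <;> omega

/-- The paths encoded by `E` with starting columns `c` end in the columns `q` and never meet. -/
def Nonintersecting {n k : ℕ} (E : Fin n → Finset (Fin k)) (c q : Fin k → ℤ) : Prop :=
  (∀ m ≤ n, Function.Injective (colAt E c m)) ∧ colAt E c n = q

theorem nonintersecting_cons {n k : ℕ} (e : Finset (Fin k)) (E : Fin n → Finset (Fin k))
    (c q : Fin k → ℤ) (hc : Function.Injective c) :
    Nonintersecting (Fin.cons e E : Fin (n + 1) → Finset (Fin k)) c q ↔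
      Nonintersecting E (stepCol e c) q := by
  rw [Nonintersecting, Nonintersecting, colAt_cons]
  refine and_congr_left fun _ =>
    ⟨fun H m hm => by rw [← colAt_cons]; exact H _ (by omega), fun H m hm => ?_⟩
  cases m with
  | zero => rwa [colAt_zero]
  | succ m => rw [colAt_cons]; exact H _ (by omega)

/-- The Lindström–Gessel–Viennot lemma for paths that move at most one column to the left
in every row. -/
theorem det_pathSum (D : ℤ → ℤ → ℝ) {k : ℕ} (q : Fin k → ℤ) (hq : StrictMono q) (n : ℕ) (a : ℤ)
    (c : Fin k → ℤ) (hc : StrictMono c) :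
    (Matrix.of fun t u => pathSum D n a (c t) (q u)).det =
      ∑ E : Fin n → Finset (Fin k), open Classical in
        if Nonintersecting E c q then
          ∏ m : Fin n, ∏ t ∈ E m, D (a + (m : ℕ)) (colAt E c m t) else 0 := by
  classical
  induction n generalizing a c with
  | zero =>
    simp only [pathSum, Nonintersecting, Finset.univ_unique, Finset.sum_singleton, nonpos_iff_eq_zero, forall_eq,
      colAt_zero, hc.injective, true_and, Finset.univ_eq_empty, Finset.prod_empty]
    split_ifs with h
    · subst h
      rw [show (Matrix.of fun t u => if c t = c u then (1 : ℝ) else 0) = 1 by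
        ext t u
        simp [Matrix.one_apply, hc.injective.eq_iff], Matrix.det_one]
    · obtain ⟨t, ht⟩ : ∃ t, ∀ u, c t ≠ q u := by
        by_contra! H
        refine h ?_
        refine (StrictMono.range_inj hc hq).1 (Set.eq_of_subset_of_ncard_le ?_ ?_ (Set.toFinite _))
        · rintro _ ⟨t, rfl⟩
          obtain ⟨u, hu⟩ := H t
          exact ⟨u, hu.symm⟩
        · rw [← Set.image_univ, ← Set.image_univ, Set.ncard_image_of_injective _ hc.injective,
            Set.ncard_image_of_injective _ hq.injective]
      exact Matrix.det_eq_zero_of_row_eq_zero t fun u => by simp [ht u]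
  | succ n ih =>
    have key : (Matrix.of fun t u => pathSum D (n + 1) a (c t) (q u)).det =
        ∑ e : Finset (Fin k), (∏ t ∈ e, D a (c t)) *
          (Matrix.of fun t u => pathSum D n (a + 1) (stepCol e c t) (q u)).det := by
      have h := (Matrix.detRowAlternating (n := Fin k) (R := ℝ)).toMultilinearMap.map_add_univ
        (fun t u => D a (c t) * pathSum D n (a + 1) (c t) (q u))
        (fun t u => pathSum D n (a + 1) (c t - 1) (q u))
      refine Eq.trans h (Finset.sum_congr rfl fun e _ => ?_)
      refine Eq.trans ?_ ((Matrix.detRowAlternating (n := Fin k) (R := ℝ)).map_piecewise_smul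
        (fun t => D a (c t)) (fun t u => pathSum D n (a + 1) (stepCol e c t) (q u)) e)
      refine congrArg (Matrix.detRowAlternating (n := Fin k) (R := ℝ)) (funext₂ fun t u => ?_)
      by_cases ht : t ∈ e <;> simp [ht, stepCol]
    rw [key, ← (Fin.consEquiv fun _ => Finset (Fin k)).sum_comp, Fintype.sum_prod_type]
    refine Finset.sum_congr rfl fun e _ => ?_
    have hE (E : Fin n → Finset (Fin k)) : Fin.consEquiv (fun _ => Finset (Fin k)) (e, E) =
      (Fin.cons e E : Fin (n + 1) → Finset (Fin k)) := rfl
    simp only [hE]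
    by_cases he : Function.Injective (stepCol e c)
    · rw [ih _ _ (stepCol_strictMono hc he), Finset.mul_sum]
      refine Finset.sum_congr rfl fun E _ => ?_
      rw [mul_ite, mul_zero]
      refine if_congr (nonintersecting_cons e E c q hc.injective).symm ?_ rfl
      rw [Fin.prod_univ_succ]
      simp only [Fin.cons_zero, Fin.cons_succ, Fin.val_zero, Fin.val_succ, colAt_zero, colAt_cons,
        Nat.cast_zero, add_zero, Nat.cast_add, Nat.cast_one, add_assoc, add_comm (1 : ℤ)]
    · have hdet : (Matrix.of fun t u => pathSum D n (a + 1) (stepCol e c t) (q u)).det = 0 := by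
        simp only [Function.Injective, not_forall] at he
        obtain ⟨t, t', h, hne⟩ := he
        exact Matrix.det_zero_of_row_eq hne (by ext u; simp [h])
      rw [hdet, mul_zero]
      refine (Finset.sum_eq_zero fun E _ => if_neg fun H => he ?_).symm
      have := ((nonintersecting_cons e E c q hc.injective).1 H).1 0 (Nat.zero_le n)
      rwa [colAt_zero] at this

theorem ChainList.fst_le {a p : ℤ × ℤ} (c : ChainList a p) : a.1 ≤ p.1 ∧ a.2 ≤ p.2 := by
  obtain ⟨l, hl, hh, hl'⟩ := c
  induction l generalizing a with
  | nil => simp at hh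
  | cons b l ih =>
    obtain rfl : b = a := by simpa using hh
    cases l with
    | nil =>
      obtain rfl : b = p := by simpa using hl'
      exact ⟨le_rfl, le_rfl⟩
    | cons d l =>
      obtain ⟨h1, h2⟩ := List.isChain_cons_cons.1 hl
      have := ih h2 rfl (by simpa using hl')
      rcases h1 with h1 | h1 <;> omega

theorem ChainList.eq_singleton {p : ℤ × ℤ} (c : ChainList p p) : c.1 = [p] := by
  obtain ⟨l, hl, hh, hl'⟩ := c
  match l with
  | [] => simp at hh
  | [b] => simpa using hh
  | b :: d :: l =>
    obtain rfl : b = p := by simpa using hh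
    obtain ⟨h1, h2⟩ := List.isChain_cons_cons.1 hl
    have := ChainList.fst_le (a := d) (p := b) ⟨d :: l, h2, rfl, by simpa using hl'⟩
    rcases h1 with h1 | h1 <;> omega

/-- Extend a chain by one cover step. -/
def ChainList.snoc {a q p : ℤ × ℤ} (h : CoverStep q p) (c : ChainList a q) : ChainList a p :=
  ⟨c.1 ++ [p], by
    obtain ⟨l, hl, hh, hl'⟩ := c
    refine ⟨?_, ?_, by simp⟩
    · refine List.isChain_append.2 ⟨hl, List.isChain_singleton _, fun u hu v hv => ?_⟩
      simp_all
    · simp [List.head?_append, hh]⟩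

theorem ChainList.exists_snoc {a p : ℤ × ℤ} (hp : p ≠ a) (c : ChainList a p) :
    ∃ q, ∃ h : CoverStep q p, ∃ c' : ChainList a q, c = c'.snoc h := by
  obtain ⟨l, hl, hh, hl'⟩ := c
  obtain ⟨m, rfl⟩ : ∃ m, l = m ++ [p] := by
    rw [List.getLast?_eq_some_iff] at hl'
    exact hl'
  obtain ⟨h1, -, h3⟩ := List.isChain_append.1 hl
  cases hm : m.getLast? with
  | none =>
    obtain rfl := List.getLast?_eq_none_iff.1 hm
    exact absurd (by simpa using hh) hp
  | some q =>
    refine ⟨q, h3 q (by simp [hm]) p (by simp), ⟨m, h1, ?_, hm⟩, rfl⟩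
    have : m ≠ [] := by rintro rfl; simp at hm
    simpa [List.head?_append_of_ne_nil _ this] using hh

theorem coverStep_iff (q p : ℤ × ℤ) :
    CoverStep q p ↔ q = (p.1 - 1, p.2) ∨ q = (p.1, p.2 - 1) := by
  simp only [CoverStep, Prod.ext_iff]
  omega

instance ChainList.finite (a p : ℤ × ℤ) : Finite (ChainList a p) := by
  by_cases h : a.1 ≤ p.1 ∧ a.2 ≤ p.2
  · obtain ⟨n, hn⟩ : ∃ n : ℕ, p.1 + p.2 - (a.1 + a.2) ≤ n :=
      ⟨(p.1 + p.2 - (a.1 + a.2)).toNat, Int.self_le_toNat _⟩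
    induction n generalizing p with
    | zero =>
      obtain rfl : p = a := by ext <;> push_cast at hn <;> omega
      have : Subsingleton (ChainList p p) :=
        ⟨fun c c' => Subtype.ext (by rw [c.eq_singleton, c'.eq_singleton])⟩
      infer_instance
    | succ n ih =>
      by_cases hp : p = a
      · subst hp
        exact ih p h (by omega)
      · have H : ∀ q, CoverStep q p → Finite (ChainList a q) := fun q hq => by
          by_cases h' : a.1 ≤ q.1 ∧ a.2 ≤ q.2
          · exact ih q h' (by push_cast at hn; rcases hq with hq | hq <;> omega)
          · have : IsEmpty (ChainList a q) := ⟨fun c => h' c.fst_le⟩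
            infer_instance
        have h1 : CoverStep (p.1 - 1, p.2) p := by simp [coverStep_iff]
        have h2 : CoverStep (p.1, p.2 - 1) p := by simp [coverStep_iff]
        have := H _ h1
        have := H _ h2
        refine Finite.of_surjective (Sum.elim (ChainList.snoc (a := a) h1) (.snoc h2)) fun c => ?_
        obtain ⟨q, hq, c', rfl⟩ := c.exists_snoc hp
        rcases (coverStep_iff q p).1 hq with rfl | rfl
        · exact ⟨.inl c', rfl⟩
        · exact ⟨.inr c', rfl⟩
  · have : IsEmpty (ChainList a p) := ⟨fun c => h c.fst_le⟩
    infer_instance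

theorem phiInv_eq_zero (x : ℤ × ℤ → ℝ) {p : ℤ × ℤ} (hp : p.1 < 1 ∨ p.2 < 1) :
    phiInv x p = 0 := by
  have : IsEmpty (ChainList (1, 1) p) := ⟨fun c => by have := c.fst_le; simp only at this; omega⟩
  rw [phiInv, finsum_of_isEmpty]

theorem phiInv_one (x : ℤ × ℤ → ℝ) : phiInv x (1, 1) = x (1, 1) := by
  have : Unique (ChainList (1, 1) (1, 1)) :=
    { default := ⟨[(1, 1)], List.isChain_singleton _, rfl, rfl⟩
      uniq := fun c => Subtype.ext c.eq_singleton }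
  rw [phiInv, finsum_unique, ChainList.eq_singleton]
  simp

theorem phiInv_rec (x : ℤ × ℤ → ℝ) {p : ℤ × ℤ} (hp : p ≠ (1, 1)) :
    phiInv x p = x p * (phiInv x (p.1 - 1, p.2) + phiInv x (p.1, p.2 - 1)) := by
  have h1 : CoverStep (p.1 - 1, p.2) p := by simp [coverStep_iff]
  have h2 : CoverStep (p.1, p.2 - 1) p := by simp [coverStep_iff]
  let e := Sum.elim (ChainList.snoc (a := (1, 1)) h1) (.snoc h2)
  have he : Function.Bijective e := by
    constructor
    · rintro (c | c) (c' | c') h <;> have h' := congrArg Subtype.val h <;>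
        simp only [e, Sum.elim_inl, Sum.elim_inr, ChainList.snoc, List.append_left_inj] at h'
      · rw [Subtype.ext h']
      · have := c.2.2.2
        rw [h', c'.2.2.2] at this
        simp at this
      · have := c.2.2.2
        rw [h', c'.2.2.2] at this
        simp at this
      · rw [Subtype.ext h']
    · intro c
      obtain ⟨q, hq, c', rfl⟩ := c.exists_snoc hp
      rcases (coverStep_iff q p).1 hq with rfl | rfl
      · exact ⟨.inl c', rfl⟩
      · exact ⟨.inr c', rfl⟩
  have hf (q : ℤ × ℤ) := Fintype.ofFinite (ChainList (1, 1) q)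
  simp only [phiInv, finsum_eq_sum_of_fintype]
  rw [← (Equiv.ofBijective e he).sum_comp, Fintype.sum_sum_type, mul_add, Finset.mul_sum,
    Finset.mul_sum]
  congr 1 <;> refine Finset.sum_congr rfl fun c _ => ?_ <;>
    simp [e, ChainList.snoc, mul_comm]

theorem phiInv_pos {r s : ℕ} {x : ℤ × ℤ → ℝ} (hx : ∀ p, inR r s p → 0 < x p) {p : ℤ × ℤ}
    (hp : inR r s p) : 0 < phiInv x p := by
  obtain ⟨n, hn⟩ : ∃ n : ℕ, p.1 + p.2 ≤ n := ⟨(p.1 + p.2).toNat, Int.self_le_toNat _⟩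
  induction n generalizing p with
  | zero => obtain ⟨h1, -, h2, -⟩ := hp; push_cast at hn; omega
  | succ n ih =>
    by_cases h : p = (1, 1)
    · subst h
      rw [phiInv_one]; exact hx _ hp
    · rw [phiInv_rec x h]
      refine mul_pos (hx p hp) ?_
      have key : ∀ q, CoverStep q p → 0 ≤ phiInv x q ∧ (1 ≤ q.1 → 1 ≤ q.2 → 0 < phiInv x q) := by
        intro q hq
        by_cases hq' : 1 ≤ q.1 ∧ 1 ≤ q.2
        · have hqR : inR r s q := by
            obtain ⟨h1, h2, h3, h4⟩ := hp
            rcases hq with hq | hq <;> exact ⟨by omega, by omega, by omega, by omega⟩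
          have := ih hqR (by push_cast at hn; rcases hq with hq | hq <;> omega)
          exact ⟨this.le, fun _ _ => this⟩
        · exact ⟨(phiInv_eq_zero x (by omega)).ge, fun h1 h2 => absurd ⟨h1, h2⟩ hq'⟩
      have k1 := key (p.1 - 1, p.2) (by simp [coverStep_iff])
      have k2 := key (p.1, p.2 - 1) (by simp [coverStep_iff])
      obtain ⟨h1, -, h3, -⟩ := hp
      by_cases hp1 : p.1 = 1
      · have : p.2 ≠ 1 := fun h2 => h (Prod.ext hp1 h2)
        exact add_pos_of_nonneg_of_pos k1.1 (k2.2 (by simpa using h1) (by simp only; omega))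
      · exact add_pos_of_pos_of_nonneg (k1.2 (by simp only; omega) (by simpa using h3)) k2.1

theorem rectList_eq (a b : ℕ) : rectList a b =
    ((List.range a).reverse.map ((↑) : ℕ → ℤ)).flatMap fun i =>
      ((List.range b).reverse.map ((↑) : ℕ → ℤ)).map fun j => (i + 1, j + 1) := by
  simp only [rectList, List.map_eq_flatMap]
  rfl

theorem mem_rectList {a b : ℕ} {p : ℤ × ℤ} : p ∈ rectList a b ↔ inR a b p := by
  obtain ⟨p1, p2⟩ := p
  simp only [rectList_eq, List.mem_flatMap, List.mem_reverse, List.mem_range, List.mem_map,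
    Prod.mk.injEq, inR]
  constructor
  · rintro ⟨_, ⟨i, hi, rfl⟩, _, ⟨j, hj, rfl⟩, rfl, rfl⟩; omega
  · rintro ⟨h1, h2, h3, h4⟩
    exact ⟨p1 - 1, ⟨(p1 - 1).toNat, by omega, by omega⟩, p2 - 1,
      ⟨(p2 - 1).toNat, by omega, by omega⟩, by omega, by omega⟩

theorem pairwise_rectList (a b : ℕ) :
    (rectList a b).reverse.Pairwise fun p q => p.1 < q.1 ∨ p.1 = q.1 ∧ p.2 < q.2 := by
  rw [List.pairwise_reverse, rectList_eq, List.pairwise_flatMap]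
  constructor
  · intro i _
    rw [List.pairwise_map, List.pairwise_map, List.pairwise_reverse]
    exact List.pairwise_lt_range.imp fun h => .inr ⟨rfl, by simpa using h⟩
  · rw [List.pairwise_map, List.pairwise_reverse]
    refine List.pairwise_lt_range.imp fun h p hp q hq => ?_
    simp only [List.mem_map] at hp hq
    obtain ⟨_, -, rfl⟩ := hp
    obtain ⟨_, -, rfl⟩ := hq
    exact .inl (by simpa using h)

theorem foldl_toggle_of_notMem (r s : ℕ) {l : List (ℤ × ℤ)} (y : ℤ × ℤ → ℝ) {p : ℤ × ℤ}
    (hp : p ∉ l) : l.foldl (fun y p => toggle r s p y) y p = y p := by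
  induction l generalizing y with
  | nil => rfl
  | cons a l ih =>
    rw [List.mem_cons, not_or] at hp
    rw [List.foldl_cons, ih _ hp.2, toggle, if_neg hp.1]

theorem mem_downSet {r s : ℕ} {p q : ℤ × ℤ} : q ∈ downSet r s p ↔ CoverStep q p ∧ inR r s q := by
  simp [downSet, coverStep_iff]

theorem mem_upSet {r s : ℕ} {p q : ℤ × ℤ} : q ∈ upSet r s p ↔ CoverStep p q ∧ inR r s q := by
  simp [upSet, CoverStep, Prod.ext_iff]

theorem dsum_congr {r s : ℕ} {y z : ℤ × ℤ → ℝ} {p : ℤ × ℤ}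
    (h : ∀ q, inR r s q → CoverStep q p → y q = z q) : dsum r s y p = dsum r s z p := by
  have : ∀ q ∈ downSet r s p, y q = z q := fun q hq =>
    h q (mem_downSet.1 hq).2 (mem_downSet.1 hq).1
  rw [dsum, dsum, Finset.sum_congr rfl this]

theorem usum_congr {r s : ℕ} {y z : ℤ × ℤ → ℝ} {p : ℤ × ℤ}
    (h : ∀ q, inR r s q → CoverStep p q → y q = z q) : usum r s y p = usum r s z p := by
  have : ∀ q ∈ upSet r s p, (y q)⁻¹ = (z q)⁻¹ := fun q hq => by
    rw [h q (mem_upSet.1 hq).2 (mem_upSet.1 hq).1]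
  rw [usum, usum, Finset.sum_congr rfl this]

theorem rhoInv_apply (r s : ℕ) (y : ℤ × ℤ → ℝ) {p : ℤ × ℤ} (hp : inR r s p) :
    rhoInv r s y p = usum r s y p * dsum r s (rhoInv r s y) p / y p := by
  have hmem : ∀ q, q ∈ (rectList r s).reverse ↔ inR r s q := fun q => by
    rw [List.mem_reverse, mem_rectList]
  have hpw := pairwise_rectList r s
  obtain ⟨l₁, l₂, hl⟩ := List.append_of_mem ((hmem p).2 hp)
  rw [hl] at hpw hmem
  rw [List.pairwise_append, List.pairwise_cons] at hpw
  obtain ⟨-, ⟨h₂, -⟩, h₁⟩ := hpw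
  have hp₁ : p ∉ l₁ := fun h => by have := h₁ p h p (by simp); omega
  have hp₂ : p ∉ l₂ := fun h => by have := h₂ p h; omega
  set z := l₁.foldl (fun y p => toggle r s p y) y with hz
  have hrho : rhoInv r s y = l₂.foldl (fun y p => toggle r s p y) (toggle r s p z) := by
    rw [rhoInv, hl, List.foldl_append, List.foldl_cons]
  have e1 : usum r s z p = usum r s y p := usum_congr fun q hq hpq => by
    refine foldl_toggle_of_notMem r s y fun h => ?_
    have := h₁ q h p (by simp)
    rcases hpq with hpq | hpq <;> omega
  have e2 : dsum r s z p = dsum r s (rhoInv r s y) p := dsum_congr fun q hq hqp => by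
    rw [hrho, foldl_toggle_of_notMem, toggle, if_neg]
    · rintro rfl
      rcases hqp with hqp | hqp <;> omega
    · intro h
      have := h₂ q h
      rcases hqp with hqp | hqp <;> omega
  rw [← e1, ← e2, ← foldl_toggle_of_notMem r s y hp₁, ← hz, hrho, foldl_toggle_of_notMem r s _ hp₂,
    toggle, if_pos rfl]

theorem toggle_pos {r s : ℕ} {y : ℤ × ℤ → ℝ} (hy : ∀ p, inR r s p → 0 < y p) (p : ℤ × ℤ) :
    ∀ q, inR r s q → 0 < toggle r s p y q := by
  intro q hq
  rw [toggle]
  split_ifs with h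
  · subst h
    refine div_pos (mul_pos ?_ ?_) (hy q hq)
    · rw [usum]
      split_ifs with h
      · exact inv_pos.2 (Finset.sum_pos (fun p hp => inv_pos.2 (hy p (Finset.mem_filter.1 hp).2)) h)
      · exact one_pos
    · rw [dsum]
      split_ifs with h
      · exact Finset.sum_pos (fun p hp => hy p (Finset.mem_filter.1 hp).2) h
      · exact one_pos
  · exact hy q hq

theorem rhoInv_pos {r s : ℕ} {y : ℤ × ℤ → ℝ} (hy : ∀ p, inR r s p → 0 < y p) :
    ∀ q, inR r s q → 0 < rhoInv r s y q := by
  rw [rhoInv]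
  generalize (rectList r s).reverse = l
  induction l generalizing y with
  | nil => exact hy
  | cons a l ih => exact ih (toggle_pos hy a)

theorem phi_rhoInv (r s : ℕ) {y : ℤ × ℤ → ℝ} (hy : ∀ p, inR r s p → 0 < y p) {p : ℤ × ℤ}
    (hp : inR r s p) : phi r s (rhoInv r s y) p = usum r s y p / y p := by
  have h := rhoInv_pos hy p hp
  have hd : dsum r s (rhoInv r s y) p ≠ 0 := fun h0 => by
    rw [rhoInv_apply r s y hp, h0] at h
    simp at h
  rw [phi, rhoInv_apply r s y hp]
  field_simp

/-- The weight of the cover step into `(a, b)` from `(a - 1, b)`, the ratio of the labels. -/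
noncomputable def vStep (r s : ℕ) (y : ℤ × ℤ → ℝ) (a b : ℤ) : ℝ :=
  if inR r s (a - 1, b) ∧ inR r s (a, b) then y (a - 1, b) / y (a, b) else 0

/-- The weight of the cover step into `(a, b)` from `(a, b - 1)`, the ratio of the labels. -/
noncomputable def hStep (r s : ℕ) (y : ℤ × ℤ → ℝ) (a b : ℤ) : ℝ :=
  if inR r s (a, b - 1) ∧ inR r s (a, b) then y (a, b - 1) / y (a, b) else 0

/-- The weight of the vertical edge of `𝒢_R` at `(a, b)`, extended by zero. -/
noncomputable def vertWt (r s : ℕ) (x : ℤ × ℤ → ℝ) (a b : ℤ) : ℝ :=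
  if inR r s (a, b) then (x (a, b))⁻¹ else 0

theorem vStep_mul_hStep (r s : ℕ) {y : ℤ × ℤ → ℝ} (hy : ∀ p, inR r s p → 0 < y p) (a b : ℤ) :
    vStep r s y (a + 1) b * hStep r s y (a + 1) (b + 1) =
      hStep r s y a (b + 1) * vStep r s y (a + 1) (b + 1) := by
  simp only [vStep, hStep, add_sub_cancel_right]
  by_cases h : inR r s (a, b) ∧ inR r s (a + 1, b + 1)
  · have h1 : inR r s (a + 1, b) := by simp only [inR] at h ⊢; omega
    have h2 : inR r s (a, b + 1) := by simp only [inR] at h ⊢; omega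
    have := (hy _ h1).ne'
    have := (hy _ h2).ne'
    simp only [h, h1, h2, and_self, if_true]
    field_simp
  · rw [ite_zero_mul_ite_zero, ite_zero_mul_ite_zero, if_neg (by tauto), if_neg (by tauto)]

theorem vertWt_eq (r s : ℕ) {x : ℤ × ℤ → ℝ} (hx : ∀ p, inR r s p → 0 < x p) {a b : ℤ}
    (hab : 3 ≤ a + b) :
    vertWt r s x a b = vStep r s (phiInv x) a b + hStep r s (phiInv x) a b := by
  by_cases hR : inR r s (a, b)
  · have hne : ((a, b) : ℤ × ℤ) ≠ (1, 1) := by simp only [ne_eq, Prod.mk.injEq]; omega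
    have hrec := phiInv_rec x hne
    have hpos := phiInv_pos hx hR
    have h1 : vStep r s (phiInv x) a b = phiInv x (a - 1, b) / phiInv x (a, b) := by
      rw [vStep]
      split_ifs with h
      · rfl
      · rw [phiInv_eq_zero x (p := (a - 1, b)), zero_div]
        simp only [inR] at h hR ⊢; omega
    have h2 : hStep r s (phiInv x) a b = phiInv x (a, b - 1) / phiInv x (a, b) := by
      rw [hStep]
      split_ifs with h
      · rfl
      · rw [phiInv_eq_zero x (p := (a, b - 1)), zero_div]
        simp only [inR] at h hR ⊢; omega
    have hx0 := (hx _ hR).ne'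
    rw [vertWt, if_pos hR, h1, h2, ← add_div, eq_div_iff hpos.ne', hrec, inv_mul_cancel_left₀ hx0]
  · simp [vertWt, vStep, hStep, hR]

theorem vertWt_phi_rhoInv (r s : ℕ) {y : ℤ × ℤ → ℝ} (hy : ∀ p, inR r s p → 0 < y p) {a b : ℤ}
    (hab : a + b < r + s) :
    vertWt r s (phi r s (rhoInv r s y)) a b = vStep r s y (a + 1) b + hStep r s y a (b + 1) := by
  by_cases hR : inR r s (a, b)
  · have hne : (upSet r s (a, b)).Nonempty := by
      simp only [inR] at hR
      by_cases ha : a < r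
      · exact ⟨(a + 1, b), mem_upSet.2 ⟨.inl ⟨rfl, rfl⟩, by simp only [inR]; omega⟩⟩
      · exact ⟨(a, b + 1), mem_upSet.2 ⟨.inr ⟨rfl, rfl⟩, by simp only [inR]; omega⟩⟩
    rw [vertWt, if_pos hR, phi_rhoInv r s hy hR, usum, if_pos hne, inv_div, div_inv_eq_mul, upSet,
      Finset.sum_filter, Finset.sum_pair (by simp), vStep, hStep]
    simp only [add_sub_cancel_right, hR, true_and, mul_add, mul_ite, mul_zero, div_eq_mul_inv]
  · simp [vertWt, vStep, hStep, hR]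

theorem pathSum_vertWt_shift (r s : ℕ) {x : ℤ × ℤ → ℝ} (hx : ∀ p, inR r s p → 0 < x p) {i j : ℤ}
    (hi : 1 ≤ i) (hj : j < r + s) :
    pathSum (vertWt r s (phi r s (rhoInv r s (phiInv x)))) r 1 i (j - r) =
      pathSum (vertWt r s x) r 1 (i + 1) (j + 1 - r) := by
  have hy : ∀ p, inR r s p → 0 < phiInv x p := fun p hp => phiInv_pos hx hp
  rw [pathSum_congr r 1 i (j - r) (1 + i) (j + 1)
      (fun a b _ hab => vertWt_phi_rhoInv r s hy (by omega)) le_rfl (by omega),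
    pathSum_congr r 1 (i + 1) (j + 1 - r) (i + 2) (j + 2)
      (fun a b hab _ => vertWt_eq r s hx (by omega)) (by omega) (by omega),
    pathSum_shift _ _ (vStep_mul_hStep r s hy), sub_add_eq_add_sub]
  · exact fun b => if_neg fun h => by simp only [inR] at h; omega
  · exact fun b => if_neg fun h => by simp only [inR] at h; omega

/-- The number of rows above the row of the boundary vertex `P_p`. -/
def startRow (s : ℕ) (p : ℤ) : ℕ := (p - s).toNat

/-- The number of rows above the row of the boundary vertex `Q_{q + r}`. -/
def endRow (r : ℕ) (q : ℤ) : ℕ := r - (1 - q).toNat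

theorem Pvert_eq (s : ℕ) (p : ℤ) : Pvert s p = ((startRow s p : ℤ) + 1, p - startRow s p) := by
  rw [Pvert, startRow]
  split_ifs <;> ext <;> simp only <;> omega

theorem Qvert_eq (r : ℕ) (q : ℤ) (hq : 1 ≤ q + r) :
    Qvert r (q + r) = ((endRow r q : ℤ) + 1, q + r - endRow r q) := by
  rw [Qvert, endRow]
  split_ifs <;> ext <;> simp only <;> omega

/-- The vertices `(m + 1, f m)` for `A ≤ m ≤ B`. -/
def pathList (f : ℕ → ℤ) (A B : ℕ) : List (ℤ × ℤ) :=
  (List.range' A (B + 1 - A)).map fun m : ℕ => ((m : ℤ) + 1, f m)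

theorem mem_pathList {f : ℕ → ℤ} {A B : ℕ} {v : ℤ × ℤ} :
    v ∈ pathList f A B ↔ ∃ m, A ≤ m ∧ m ≤ B ∧ ((m : ℤ) + 1, f m) = v := by
  simp only [pathList, List.mem_map, List.mem_range'_1]
  exact ⟨fun ⟨m, h, h'⟩ => ⟨m, by omega, by omega, h'⟩,
    fun ⟨m, h1, h2, h'⟩ => ⟨m, ⟨h1, by omega⟩, h'⟩⟩

theorem pathList_congr {f g : ℕ → ℤ} {A B : ℕ} :
    pathList f A B = pathList g A B ↔ ∀ m, A ≤ m → m ≤ B → f m = g m := by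
  simp only [pathList, List.map_inj_left, List.mem_range'_1, Prod.mk.injEq, true_and]
  exact ⟨fun h m h1 h2 => h m ⟨h1, by omega⟩, fun h m hm => h m hm.1 (by omega)⟩

theorem pathList_cons {f : ℕ → ℤ} {A B : ℕ} (h : A ≤ B) :
    pathList f A B = ((A : ℤ) + 1, f A) :: pathList f (A + 1) B := by
  rw [pathList, pathList, show B + 1 - A = (B + 1 - (A + 1)) + 1 by omega, List.range'_succ,
    List.map_cons]

theorem pathList_eq_nil {f : ℕ → ℤ} {A B : ℕ} (h : B < A) : pathList f A B = [] := by
  rw [pathList, show B + 1 - A = 0 by omega]; rfl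

theorem head?_pathList {f : ℕ → ℤ} {A B : ℕ} (h : A ≤ B) :
    (pathList f A B).head? = some ((A : ℤ) + 1, f A) := by
  rw [pathList_cons h, List.head?_cons]

theorem getLast?_pathList {f : ℕ → ℤ} {A B : ℕ} (h : A ≤ B) :
    (pathList f A B).getLast? = some ((B : ℤ) + 1, f B) := by
  rw [pathList, List.getLast?_map, show B + 1 - A = (B - A) + 1 by omega, List.range'_concat,
    List.getLast?_concat]
  simp [h]

theorem isChain_pathList {R : ℤ × ℤ → ℤ × ℤ → Prop} {f : ℕ → ℤ} {A B : ℕ}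
    (h : ∀ m, A ≤ m → m < B → R ((m : ℤ) + 1, f m) ((m : ℤ) + 1 + 1, f (m + 1))) :
    (pathList f A B).IsChain R := by
  rw [pathList, List.isChain_map, List.isChain_iff_getElem]
  intro n hn
  simp only [List.length_range'] at hn
  simp only [List.getElem_range', one_mul]
  have := h (A + n) (by omega) (by omega)
  simpa [add_assoc] using this

theorem listWt_pathList (x : ℤ × ℤ → ℝ) (f : ℕ → ℤ) {A B : ℕ} (h : A ≤ B) :
    listWt x (pathList f A B) =
      ∏ m ∈ Finset.Ico A B, edgeWt x ((m : ℤ) + 1, f m) ((m : ℤ) + 1 + 1, f (m + 1)) := by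
  obtain ⟨n, rfl⟩ := Nat.exists_eq_add_of_le h
  induction n generalizing A with
  | zero =>
    rw [pathList_cons h, pathList_eq_nil (by omega)]
    simp [listWt]
  | succ n ih =>
    rw [Finset.prod_eq_prod_Ico_succ_bot (by omega), show A + (n + 1) = A + 1 + n by ring,
      ← ih (by omega), pathList_cons (by omega), pathList_cons (by omega)]
    simp [listWt]

/-- A path in `𝒢_R`, prolonged to the first and to the last row by diagonal steps. -/
def IsPadded (r s : ℕ) (f : ℕ → ℤ) : Prop :=
  ∀ m < r, f (m + 1) = f m ∧ inR r s ((m : ℤ) + 1, f m) ∨ f (m + 1) = f m - 1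

namespace IsPadded

variable {r s : ℕ} {f : ℕ → ℤ}

theorem antitone (hf : IsPadded r s f) {m n : ℕ} (hmn : m ≤ n) (hn : n ≤ r) : f n ≤ f m := by
  induction n, hmn using Nat.le_induction with
  | base => rfl
  | succ n _ ih =>
    have := ih (by omega)
    rcases hf n (by omega) with h | h <;> omega

theorem eq_of_le_startRow (hf : IsPadded r s f) {m : ℕ} (hm : m ≤ startRow s (f 0)) (hmr : m ≤ r) :
    f m = f 0 - m := by
  induction m with
  | zero => simp
  | succ m ih =>
    have := ih (by omega) (by omega)
    rw [startRow] at hm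
    push_cast
    rcases hf m (by omega) with ⟨-, -, -, -, h⟩ | h
    · simp only at h; omega
    · omega

theorem eq_of_endRow_le (hf : IsPadded r s f) {m : ℕ} (hm : endRow r (f r) ≤ m) (hmr : m ≤ r) :
    f m = f r + r - m := by
  induction hmr using Nat.decreasingInduction with
  | self => ring
  | of_succ m hmr ih =>
    have := ih (by omega)
    rw [endRow] at hm
    push_cast at this
    rcases hf m hmr with ⟨h, -, -, h', -⟩ | h
    · simp only at h'; omega
    · omega

theorem startRow_le_endRow (hf : IsPadded r s f) (hs : 1 ≤ s) (h0 : f 0 ≤ r + s)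
    (hr : 1 ≤ f r + r) : startRow s (f 0) ≤ endRow r (f r) := by
  by_contra! h
  have hA : startRow s (f 0) ≤ r := by rw [startRow]; omega
  have h1 := hf.eq_of_le_startRow h.le (by omega)
  have h2 := hf.eq_of_endRow_le le_rfl (by omega)
  rw [startRow, endRow] at *
  omega

theorem lt_startRow_iff (hf : IsPadded r s f) (h0 : f 0 ≤ r + s) {m : ℕ} (hm : m ≤ r) :
    m < startRow s (f 0) ↔ s < f m := by
  have hA : startRow s (f 0) ≤ r := by rw [startRow]; omega
  constructor
  · intro h
    have := hf.eq_of_le_startRow h.le hm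
    rw [startRow] at h
    omega
  · contrapose!
    intro h
    have h1 := hf.eq_of_le_startRow le_rfl hA
    have h2 := hf.antitone h hm
    rw [startRow] at *
    omega

theorem endRow_lt_iff (hf : IsPadded r s f) (hr : 1 ≤ f r + r) {m : ℕ} (hm : m ≤ r) :
    endRow r (f r) < m ↔ f m < 1 := by
  have hB : endRow r (f r) ≤ r := by rw [endRow]; omega
  constructor
  · intro h
    have := hf.eq_of_endRow_le h.le hm
    rw [endRow] at h
    omega
  · contrapose!
    intro h
    have h1 := hf.eq_of_endRow_le le_rfl hB
    have h2 := hf.antitone h hB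
    rw [endRow] at *
    omega

end IsPadded

/-- Every directed path of `𝒢_R` between boundary vertices comes from a padded path. -/
theorem exists_isPadded {r s : ℕ} {l : List (ℤ × ℤ)} {p q : ℤ} (hl : l.IsChain (GEdge r s))
    (hp : p ≤ r + s) (hq : 1 ≤ q + r)
    (hh : l.head? = some (Pvert s p)) (hh' : l.getLast? = some (Qvert r (q + r))) :
    ∃ f, IsPadded r s f ∧ f 0 = p ∧ f r = q ∧ l = pathList f (startRow s p) (endRow r q) := by
  have key : ∀ (l : List (ℤ × ℤ)) (A B : ℕ) (b b' : ℤ), l.IsChain (GEdge r s) →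
      l.head? = some ((A : ℤ) + 1, b) → l.getLast? = some ((B : ℤ) + 1, b') →
      ∃ f : ℕ → ℤ, A ≤ B ∧ f A = b ∧ f B = b' ∧ l = pathList f A B ∧
        ∀ m, A ≤ m → m < B → GEdge r s ((m : ℤ) + 1, f m) ((m : ℤ) + 1 + 1, f (m + 1)) := by
    intro l
    induction l with
    | nil => intro A B b b' _ h; simp at h
    | cons v l ih =>
      intro A B b b' hl hh hh'
      obtain rfl : v = ((A : ℤ) + 1, b) := by simpa using hh
      cases l with
      | nil =>
        simp only [List.getLast?_singleton, Option.some.injEq, Prod.mk.injEq, add_left_inj,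
          Nat.cast_inj] at hh'
        obtain ⟨rfl, rfl⟩ := hh'
        refine ⟨fun _ => b, le_rfl, rfl, rfl, ?_, fun m h1 h2 => by omega⟩
        rw [pathList_cons le_rfl, pathList_eq_nil (by omega)]
      | cons w l =>
        obtain ⟨h1, h2⟩ := List.isChain_cons_cons.1 hl
        obtain ⟨d, rfl⟩ : ∃ d, w = (((A + 1 : ℕ) : ℤ) + 1, d) :=
          ⟨w.2, Prod.ext (h1.2.2.2.2.1.trans (by push_cast; rfl)) rfl⟩
        obtain ⟨f, hAB, hfA, hfB, hf, hE⟩ := ih (A + 1) B _ b' h2 rfl (by simpa using hh')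
        have hne : ∀ m, A + 1 ≤ m → Function.update f A b m = f m := fun m hm =>
          Function.update_of_ne (by omega) _ _
        refine ⟨Function.update f A b, by omega, by simp, by rw [hne B hAB, hfB], ?_, ?_⟩
        · rw [pathList_cons (by omega), Function.update_self, hf, List.cons.injEq]
          exact ⟨rfl, pathList_congr.2 fun m hm _ => (hne m hm).symm⟩
        · intro m hm hmB
          rcases hm.eq_or_lt with rfl | hm
          · rw [Function.update_self, hne _ le_rfl, hfA]
            exact_mod_cast h1
          · rw [hne m hm, hne (m + 1) (by omega)]
            exact hE m hm hmB
  rw [Pvert_eq] at hh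
  rw [Qvert_eq r q hq] at hh'
  obtain ⟨f, hAB, hfA, hfB, hf, hE⟩ := key l _ _ _ _ hl hh hh'
  have hAr : startRow s p ≤ r := by rw [startRow]; omega
  have hBr : endRow r q ≤ r := by rw [endRow]; omega
  refine ⟨fun m => if m < startRow s p then p - m else if m ≤ endRow r q then f m else q + r - m,
    fun m hm => ?_, ?_, ?_, ?_⟩
  · rcases lt_or_ge m (startRow s p) with h | h
    · right
      rcases (Nat.succ_le_of_lt h).eq_or_lt with h' | h'
      · rw [Nat.succ_eq_add_one] at h'
        simp only [h, if_true, h', lt_irrefl, if_false, hAB, hfA]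
        rw [← h']; push_cast; ring
      · rw [Nat.succ_eq_add_one] at h'
        simp only [h, h', if_true]; push_cast; ring
    · rcases lt_or_ge m (endRow r q) with h' | h'
      · have e1 : ¬ m < startRow s p := by omega
        have e2 : ¬ m + 1 < startRow s p := by omega
        have e3 : m + 1 ≤ endRow r q := h'
        simp only [e1, e2, e3, h'.le, if_true, if_false]
        obtain ⟨g1, g2, g3, g4, -, g5⟩ := hE m h h'
        rcases g5 with g5 | g5
        · exact .inl ⟨g5, g1, g2, g3, g4⟩
        · exact .inr g5.1
      · right
        have e1 : ¬ m < startRow s p := by omega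
        have e2 : ¬ m + 1 < startRow s p := by omega
        have e3 : ¬ m + 1 ≤ endRow r q := by omega
        simp only [e1, e2, e3, if_false]
        split_ifs with h''
        · obtain rfl : m = endRow r q := by omega
          rw [hfB]; push_cast; ring
        · push_cast; ring
  · simp only [Nat.zero_le, if_true, Nat.cast_zero, sub_zero]
    split_ifs with h
    · rfl
    · rw [show startRow s p = 0 by omega] at hfA
      simpa using hfA
  · simp only [show ¬ r < startRow s p by omega, if_false]
    split_ifs with h
    · rw [show endRow r q = r by omega] at hfB
      rw [hfB]; ring
    · ring
  · rw [hf]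
    exact pathList_congr.2 fun m h1 h2 => by simp [h2, h1.not_gt]

section PathSystems

variable {r s k : ℕ} {i j : ℤ}

/-- The (prolonged) starting columns of the paths from `P_i, …, P_{i+k-1}`. -/
def startCol (k : ℕ) (i : ℤ) : Fin k → ℤ := fun t => i + (t : ℕ)

/-- The (prolonged) final columns of the paths to `Q_j, …, Q_{j+k-1}`. -/
def endCol (r k : ℕ) (j : ℤ) : Fin k → ℤ := fun t => j + (t : ℕ) - r

theorem startCol_strictMono (k : ℕ) (i : ℤ) : StrictMono (startCol k i) := fun t t' h => by
  have := Fin.lt_def.1 h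
  simp only [startCol]; omega

theorem endCol_strictMono (r k : ℕ) (j : ℤ) : StrictMono (endCol r k j) := fun t t' h => by
  have := Fin.lt_def.1 h
  simp only [endCol]; omega

/-- `E` encodes a nonintersecting collection of paths in `𝒢_R`: path `t` uses a vertical edge in
row `m + 1` exactly when `t ∈ E m`. -/
def IsEncoding (r s : ℕ) (i j : ℤ) (E : Fin r → Finset (Fin k)) : Prop :=
  Nonintersecting E (startCol k i) (endCol r k j) ∧
    ∀ m : Fin r, ∀ t ∈ E m, inR r s (((m : ℕ) : ℤ) + 1, colAt E (startCol k i) m t)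

theorem mem_iff_colAt_succ (E : Fin r → Finset (Fin k)) (c : Fin k → ℤ) (m : Fin r) (t : Fin k) :
    t ∈ E m ↔ colAt E c (m + 1) t = colAt E c m t := by
  rw [colAt_succ, stepCol]
  split_ifs with h <;> simp [h]

namespace IsEncoding

variable {E : Fin r → Finset (Fin k)}

theorem isPadded (hE : IsEncoding r s i j E) (t : Fin k) :
    IsPadded r s fun m => colAt E (startCol k i) m t := by
  intro m hm
  have h := colAt_succ E (startCol k i) ⟨m, hm⟩
  simp only at h
  simp only [h, stepCol]
  split_ifs with ht
  · exact .inl ⟨rfl, hE.2 ⟨m, hm⟩ t ht⟩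
  · exact .inr rfl

theorem colAt_last (hE : IsEncoding r s i j E) (t : Fin k) :
    colAt E (startCol k i) r t = endCol r k j t := congrFun hE.1.2 t

end IsEncoding

/-- The list of vertices of path `t` in the collection encoded by `E`. -/
def encodedPath (s : ℕ) (i j : ℤ) (E : Fin r → Finset (Fin k)) (t : Fin k) : List (ℤ × ℤ) :=
  pathList (fun m => colAt E (startCol k i) m t) (startRow s (startCol k i t))
    (endRow r (endCol r k j t))

/-- The ranges of indices for which the boundary vertices exist. -/
structure InRange (r s k : ℕ) (i j : ℤ) : Prop where
  one_le_s : 1 ≤ s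
  one_le_i : 1 ≤ i
  i_le : i + k - 1 ≤ r + s
  one_le_j : 1 ≤ j
  j_le : j + k - 1 ≤ r + s

namespace InRange

variable (h : InRange r s k i j) (t : Fin k)
include h

theorem startCol_le : startCol k i t ≤ r + s := by
  have := h.i_le; simp only [startCol]; omega

theorem one_le_endCol : 1 ≤ endCol r k j t + r := by
  have := h.one_le_j; simp only [endCol]; omega

theorem startRow_le_endRow {E : Fin r → Finset (Fin k)} (hE : IsEncoding r s i j E) :
    startRow s (startCol k i t) ≤ endRow r (endCol r k j t) := by
  have := (hE.isPadded t).startRow_le_endRow h.one_le_s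
  simp only [colAt_zero, hE.colAt_last] at this
  exact this (h.startCol_le t) (h.one_le_endCol t)

end InRange

theorem endRow_le (r : ℕ) (q : ℤ) : endRow r q ≤ r := Nat.sub_le _ _

/-- The collection of paths encoded by `E`. -/
def IsEncoding.toGSys (h : InRange r s k i j) {E : Fin r → Finset (Fin k)}
    (hE : IsEncoding r s i j E) : GSys r s i j k where
  perm := 1
  path := encodedPath s i j E
  chain t := isChain_pathList fun m hm hm' => by
    have hr := endRow_le r (endCol r k j t)
    have hf := hE.isPadded t
    have h1 := hf.lt_startRow_iff (m := m) (by simpa using h.startCol_le t) (by omega)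
    have h2 := hf.endRow_lt_iff (m := m) (by simpa [hE.colAt_last] using h.one_le_endCol t)
      (by omega)
    have h3 := hf.endRow_lt_iff (m := m + 1) (by simpa [hE.colAt_last] using h.one_le_endCol t)
      (by omega)
    simp only [colAt_zero, hE.colAt_last] at h1 h2 h3
    have h4 := hf m (by omega)
    simp only at h4
    refine ⟨by simp only; omega, by simp only; omega, by simp only; omega, by simp only; omega,
      rfl, ?_⟩
    simp only
    omega
  first t := by
    rw [encodedPath, head?_pathList (h.startRow_le_endRow t hE)]
    have hA : startRow s (startCol k i t) ≤ r := by
      have := h.startCol_le t; rw [startRow]; omega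
    have := (hE.isPadded t).eq_of_le_startRow (m := startRow s (startCol k i t))
      (by simp) hA
    simp only [colAt_zero] at this
    rw [this, ← Pvert_eq]
    rfl
  final t := by
    rw [encodedPath, getLast?_pathList (h.startRow_le_endRow t hE)]
    have := (hE.isPadded t).eq_of_endRow_le (m := endRow r (endCol r k j t))
      (by simp [hE.colAt_last]) (endRow_le _ _)
    simp only [hE.colAt_last] at this
    rw [this, ← Qvert_eq _ _ (h.one_le_endCol t)]
    simp [endCol]
  disjoint t t' htt' v hv hv' := by
    obtain ⟨m, -, hm, rfl⟩ := mem_pathList.1 hv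
    obtain ⟨m', -, -, he⟩ := mem_pathList.1 hv'
    simp only [Prod.mk.injEq, add_left_inj, Nat.cast_inj] at he
    obtain ⟨rfl, he⟩ := he
    exact htt' (hE.1.1 m' (hm.trans (endRow_le _ _)) he.symm)

theorem GSys.ext' {L L' : GSys r s i j k} (h : L.perm = L'.perm) (h' : L.path = L'.path) :
    L = L' := by
  cases L; cases L'; cases h; cases h'; rfl

theorem toGSys_injective (h : InRange r s k i j) {E E' : Fin r → Finset (Fin k)}
    (hE : IsEncoding r s i j E) (hE' : IsEncoding r s i j E') (heq : hE.toGSys h = hE'.toGSys h) :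
    E = E' := by
  have key : ∀ m ≤ r, ∀ t, colAt E (startCol k i) m t = colAt E' (startCol k i) m t := by
    intro m hm t
    have h1 := pathList_congr.1 (congrFun (congrArg GSys.path heq) t) m
    by_cases hA : startRow s (startCol k i t) ≤ m
    · by_cases hB : m ≤ endRow r (endCol r k j t)
      · exact h1 hA hB
      · have e := (hE.isPadded t).eq_of_endRow_le (m := m) (by simp only [hE.colAt_last]; omega) hm
        have e' := (hE'.isPadded t).eq_of_endRow_le (m := m)
          (by simp only [hE'.colAt_last]; omega) hm
        simp only [hE.colAt_last, hE'.colAt_last] at e e'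
        rw [e, e']
    · have e := (hE.isPadded t).eq_of_le_startRow (m := m) (by simp only [colAt_zero]; omega) hm
      have e' := (hE'.isPadded t).eq_of_le_startRow (m := m) (by simp only [colAt_zero]; omega) hm
      simp only [colAt_zero] at e e'
      rw [e, e']
  ext m t
  rw [mem_iff_colAt_succ E (startCol k i), mem_iff_colAt_succ E' (startCol k i),
    key _ m.2.le, key _ m.2]

theorem exists_toGSys (h : InRange r s k i j) (L : GSys r s i j k) :
    ∃ (E : Fin r → Finset (Fin k)) (hE : IsEncoding r s i j E), hE.toGSys h = L := by
  classical
  have hQ (t : Fin k) : Qvert r (j + (L.perm t : ℕ)) = Qvert r (endCol r k j (L.perm t) + r) := by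
    simp [endCol]
  choose f hf hf0 hfr hfL using fun t => exists_isPadded (L.chain t) (h.startCol_le t)
    (h.one_le_endCol (L.perm t)) (L.first t)
    ((L.final t).trans (congrArg some (hQ t)))
  let E : Fin r → Finset (Fin k) := fun m => {t | f t (m + 1) = f t m}
  have hcol : ∀ m ≤ r, ∀ t, colAt E (startCol k i) m t = f t m := by
    intro m hm
    induction m with
    | zero => intro t; rw [colAt_zero, hf0]
    | succ m ih =>
      intro t
      have := colAt_succ E (startCol k i) ⟨m, hm⟩
      simp only at this
      rw [this, stepCol, ih (by omega)]
      simp only [E, Finset.mem_filter, Finset.mem_univ, true_and]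
      split_ifs with h'
      · exact h'.symm
      · rcases hf t m hm with h'' | h''
        · exact absurd h''.1 h'
        · exact h''.symm
  have hinj : ∀ m ≤ r, Function.Injective (colAt E (startCol k i) m) := by
    intro m hm t t' htt'
    rw [hcol m hm, hcol m hm] at htt'
    have a1 (t) := (hf t).lt_startRow_iff (by rw [hf0]; exact h.startCol_le t) hm
    have a2 (t) := (hf t).endRow_lt_iff (by rw [hfr]; exact h.one_le_endCol _) hm
    simp only [hf0, hfr] at a1 a2
    by_cases hA : startRow s (startCol k i t) ≤ m
    · have hA' : startRow s (startCol k i t') ≤ m := by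
        have := a1 t; have := a1 t'; omega
      by_cases hB : m ≤ endRow r (endCol r k j (L.perm t))
      · have hB' : m ≤ endRow r (endCol r k j (L.perm t')) := by
          have := a2 t; have := a2 t'; omega
        by_contra hne
        refine L.disjoint t t' hne ((m : ℤ) + 1, f t m) ?_ ?_
        · rw [hfL t]; exact mem_pathList.2 ⟨m, hA, hB, rfl⟩
        · rw [hfL t', htt']; exact mem_pathList.2 ⟨m, hA', hB', rfl⟩
      · have hB' : ¬ m ≤ endRow r (endCol r k j (L.perm t')) := by
          have := a2 t; have := a2 t'; omega
        have e := (hf t).eq_of_endRow_le (m := m) (by rw [hfr]; omega) hm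
        have e' := (hf t').eq_of_endRow_le (m := m) (by rw [hfr]; omega) hm
        rw [hfr] at e e'
        exact L.perm.injective ((endCol_strictMono r k j).injective (by omega))
    · have hA' : ¬ startRow s (startCol k i t') ≤ m := by
        have := a1 t; have := a1 t'; omega
      have e := (hf t).eq_of_le_startRow (m := m) (by rw [hf0]; omega) hm
      have e' := (hf t').eq_of_le_startRow (m := m) (by rw [hf0]; omega) hm
      rw [hf0] at e e'
      exact (startCol_strictMono k i).injective (by omega)
  have hmono : ∀ m ≤ r, StrictMono (colAt E (startCol k i) m) := by
    intro m hm
    induction m with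
    | zero => rw [colAt_zero]; exact startCol_strictMono k i
    | succ m ih =>
      have h1 := hinj (m + 1) hm
      have h2 := colAt_succ E (startCol k i) ⟨m, hm⟩
      simp only at h2
      rw [h2] at h1 ⊢
      exact stepCol_strictMono (ih (by omega)) h1
  have hperm : L.perm = 1 := by
    have h1 : StrictMono L.perm := fun t t' htt' => by
      have := hmono r le_rfl htt'
      rw [hcol r le_rfl, hcol r le_rfl, hfr, hfr] at this
      exact (endCol_strictMono r k j).lt_iff_lt.1 this
    exact Equiv.coe_fn_injective ((StrictMono.range_inj h1 strictMono_id).1 (by simp))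
  simp only [hperm, Equiv.Perm.coe_one, id_eq] at hfr hfL
  have hE : IsEncoding r s i j E := by
    refine ⟨⟨hinj, funext fun t => by rw [hcol r le_rfl, hfr]⟩, fun m t ht => ?_⟩
    rw [hcol m m.2.le]
    have ht' : f t (m + 1) = f t m := by simpa [E] using ht
    rcases hf t m m.2 with h' | h'
    · exact h'.2
    · omega
  refine ⟨E, hE, GSys.ext' hperm.symm (funext fun t => ?_)⟩
  rw [hfL t]
  exact pathList_congr.2 fun m _ hm => hcol m (hm.trans (endRow_le _ _)) t

theorem GSysWeight_toGSys (x : ℤ × ℤ → ℝ) (h : InRange r s k i j) {E : Fin r → Finset (Fin k)}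
    (hE : IsEncoding r s i j E) :
    GSysWeight x (hE.toGSys h) = ∏ m : Fin r, ∏ t ∈ E m,
      vertWt r s x (1 + ((m : ℕ) : ℤ)) (colAt E (startCol k i) m t) := by
  classical
  have key : ∀ t, listWt x ((hE.toGSys h).path t) = ∏ m : Fin r, if t ∈ E m then
      vertWt r s x (1 + ((m : ℕ) : ℤ)) (colAt E (startCol k i) m t) else 1 := by
    intro t
    have hr := endRow_le r (endCol r k j t)
    have hf := hE.isPadded t
    change listWt x (pathList _ _ _) = _
    rw [listWt_pathList _ _ (h.startRow_le_endRow t hE)]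
    have hout : ∀ m < r, m ∉ Finset.Ico (startRow s (startCol k i t)) (endRow r (endCol r k j t)) →
        colAt E (startCol k i) (m + 1) t ≠ colAt E (startCol k i) m t := by
      intro m hm hmI heq
      rw [Finset.mem_Ico] at hmI
      have h1 := hf.lt_startRow_iff (m := m) (by simpa using h.startCol_le t) (by omega)
      have h3 := hf.endRow_lt_iff (m := m + 1) (by simpa [hE.colAt_last] using h.one_le_endCol t)
        (by omega)
      simp only [colAt_zero, hE.colAt_last] at h1 h3
      rcases hf m hm with ⟨-, -, -, h4, h5⟩ | h4
      · simp only at h4 h5; omega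
      · simp only at h4; omega
    rw [Finset.prod_subset (s₂ := Finset.range r)
      (f := fun m : ℕ => edgeWt x ((m : ℤ) + 1, colAt E (startCol k i) m t)
        ((m : ℤ) + 1 + 1, colAt E (startCol k i) (m + 1) t))
      (fun m hm => by rw [Finset.mem_Ico] at hm; rw [Finset.mem_range]; omega)
      (fun m hm hmI => if_neg (hout m (Finset.mem_range.1 hm) hmI)), Finset.prod_range]
    refine Finset.prod_congr rfl fun m _ => ?_
    rw [edgeWt]
    refine ite_congr (propext (mem_iff_colAt_succ E _ m t).symm) (fun ht => ?_) fun _ => rfl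
    rw [vertWt, add_comm (1 : ℤ), if_pos (hE.2 m t ht)]
  rw [GSysWeight, Finset.prod_congr rfl fun t _ => key t, Finset.prod_comm]
  exact Finset.prod_congr rfl fun m _ => by simp [Finset.prod_ite_mem]

theorem finsum_GSysWeight (x : ℤ × ℤ → ℝ) (h : InRange r s k i j) :
    ∑ᶠ L : GSys r s i j k, GSysWeight x L =
      (Matrix.of fun t u => pathSum (vertWt r s x) r 1 (startCol k i t) (endCol r k j u)).det := by
  classical
  rw [det_pathSum _ _ (endCol_strictMono r k j) _ _ _ (startCol_strictMono k i)]
  let F : {E : Fin r → Finset (Fin k) // IsEncoding r s i j E} → GSys r s i j k :=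
    fun E => E.2.toGSys h
  have hF : Function.Bijective F :=
    ⟨fun E E' hEE' => Subtype.ext (toGSys_injective h E.2 E'.2 hEE'), fun L => by
      obtain ⟨E, hE, hL⟩ := exists_toGSys h L
      exact ⟨⟨E, hE⟩, hL⟩⟩
  rw [← finsum_eq_of_bijective F hF fun E => (GSysWeight_toGSys x h E.2).symm,
    finsum_eq_sum_of_fintype, ← Finset.sum_subtype (Finset.univ.filter (IsEncoding r s i j))
      (by simp) (fun E => ∏ m : Fin r, ∏ t ∈ E m,
        vertWt r s x (1 + ((m : ℕ) : ℤ)) (colAt E (startCol k i) m t)), Finset.sum_filter]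
  refine Finset.sum_congr rfl fun E _ => ?_
  by_cases hN : Nonintersecting E (startCol k i) (endCol r k j)
  · rw [if_pos hN]
    split_ifs with hE
    · rfl
    · have : ∃ m, ∃ t ∈ E m, ¬ inR r s (((m : ℕ) : ℤ) + 1, colAt E (startCol k i) m t) := by
        by_contra! hall
        exact hE ⟨hN, hall⟩
      obtain ⟨m, t, ht, hout⟩ := this
      refine (Finset.prod_eq_zero (Finset.mem_univ m) (Finset.prod_eq_zero ht ?_)).symm
      rw [vertWt, add_comm (1 : ℤ), if_neg hout]
  · rw [if_neg hN, if_neg fun hE : IsEncoding r s i j E => hN hE.1]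

end PathSystems

theorem W_eq_det {r s k : ℕ} {i j : ℤ} (x : ℤ × ℤ → ℝ) (hk : k ≠ 0) (h : InRange r s k i j) :
    W r s x i j k =
      (Matrix.of fun t u => pathSum (vertWt r s x) r 1 (startCol k i t) (endCol r k j u)).det := by
  rw [W, if_neg (by omega), if_neg (by omega),
    if_pos ⟨h.one_le_i, h.one_le_j, h.i_le, h.j_le⟩]
  exact finsum_GSysWeight x h

/-- The array of path weights shifts under inverse rowmotion: with
`x̃ = φ(ρ⁻¹(φ⁻¹(x)))`, one has `W_{ij}^{(k)}(x̃) = W_{i+1,j+1}^{(k)}(x)` for all `k ≥ 1`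
and `1 ≤ i, j ≤ r + s - k`. -/
theorem W_shift (r s : ℕ) (hr : 1 ≤ r) (hs : 1 ≤ s) (x : ℤ × ℤ → ℝ)
    (hx : ∀ p, inR r s p → 0 < x p) (k : ℤ) (hk : 1 ≤ k) (i j : ℤ)
    (hi1 : 1 ≤ i) (hi2 : i ≤ (r : ℤ) + s - k) (hj1 : 1 ≤ j) (hj2 : j ≤ (r : ℤ) + s - k) :
    W r s (phi r s (rhoInv r s (phiInv x))) i j k = W r s x (i + 1) (j + 1) k := by
  lift k to ℕ using by omega
  rw [W_eq_det _ (by omega) ⟨hs, hi1, by omega, hj1, by omega⟩,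
    W_eq_det _ (by omega) ⟨hs, by omega, by omega, by omega, by omega⟩]
  congr 2
  ext t u
  rw [startCol, endCol, pathSum_vertWt_shift r s hx (by omega) (by omega), startCol, endCol]
  congr 1 <;> ring

end Paper
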